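/- Let K(x,y) = 1 - tx - txy^2/((x-y)(y-1)). The birational involutions Φ(u,v) = (v(uv-u+v)/((u-v)(v-1)), v) and Ψ(u,v) = (u, uv/(uv-u+v)) each preserve the value of K, and the group of birational transformations they generate is dihedral of order 10; in particular (Φ∘Ψ)^5 = identity. -/

import Mathlib

/-- The field `ℚ(t, x, y)` of rational functions in three variables. -/
noncomputable abbrev RF : Type := RatFunc (RatFunc (RatFunc ℚ))

/-- The variable `t`. -/
noncomputable def tF : RF := RatFunc.C (RatFunc.C RatFunc.X)
/-- The variable `x`. -/
noncomputable def xF : RF := RatFunc.C RatFunc.X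
/-- The variable `y`. -/
noncomputable def yF : RF := RatFunc.X

/-- The kernel `K(u,v) = 1 - t u - t u v²/((u-v)(v-1))`. -/
noncomputable def Ker (u v : RF) : RF :=
  1 - tF * u - tF * u * v ^ 2 / ((u - v) * (v - 1))

/-- The birational transformation `Φ`. -/
noncomputable def PhiT (p : RF × RF) : RF × RF :=
  (p.2 * (p.1 * p.2 - p.1 + p.2) / ((p.1 - p.2) * (p.2 - 1)), p.2)

/-- The birational transformation `Ψ`. -/
noncomputable def PsiT (p : RF × RF) : RF × RF :=
  (p.1, p.1 * p.2 / (p.1 * p.2 - p.1 + p.2))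

/-- The embedding of `ℚ[x][y]` into `ℚ(t, x, y)`. -/
noncomputable def polyToRF : Polynomial (Polynomial ℚ) →+* RF :=
  (algebraMap (Polynomial (RatFunc (RatFunc ℚ))) RF).comp
    (Polynomial.mapRingHom
      ((algebraMap (Polynomial (RatFunc ℚ)) (RatFunc (RatFunc ℚ))).comp
        (Polynomial.mapRingHom RatFunc.C)))

lemma polyToRF_injective : Function.Injective polyToRF :=
  (RatFunc.algebraMap_injective _).comp (Polynomial.map_injective _
    ((RatFunc.algebraMap_injective _).comp (Polynomial.map_injective _
      (RatFunc.C (K := ℚ)).injective)))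

lemma polyToRF_C_X : polyToRF (Polynomial.C Polynomial.X) = xF := by
  simp [polyToRF, xF]

lemma polyToRF_X : polyToRF Polynomial.X = yF := by
  simp [polyToRF, yF]

/-- A polynomial in `x` and `y` which does not vanish at some rational point is nonzero. -/
lemma polyToRF_ne_zero (P : Polynomial (Polynomial ℚ)) (a b : ℚ)
    (h : P.evalEval a b ≠ 0) : polyToRF P ≠ 0 := by
  rw [map_ne_zero_iff _ polyToRF_injective]
  rintro rfl
  simp at h

section Nonvanishing

open Polynomial

lemma xF_ne_zero : xF ≠ 0 := by
  have h := polyToRF_ne_zero (C X) 5 3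
    (by norm_num [Polynomial.evalEval])
  simpa [polyToRF_C_X, polyToRF_X, map_ofNat] using h

lemma yF_ne_zero : yF ≠ 0 := by
  have h := polyToRF_ne_zero X 5 3
    (by norm_num [Polynomial.evalEval])
  simpa [polyToRF_C_X, polyToRF_X, map_ofNat] using h

lemma xF_sub_yF_ne_zero : xF - yF ≠ 0 := by
  have h := polyToRF_ne_zero (C X - X) 5 3
    (by norm_num [Polynomial.evalEval])
  simpa [polyToRF_C_X, polyToRF_X, map_ofNat] using h

lemma yF_sub_one_ne_zero : yF - 1 ≠ 0 := by
  have h := polyToRF_ne_zero (X - 1) 5 3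
    (by norm_num [Polynomial.evalEval])
  simpa [polyToRF_C_X, polyToRF_X, map_ofNat] using h

lemma xF_mul_yF_sub_add_ne_zero : xF * yF - xF + yF ≠ 0 := by
  have h := polyToRF_ne_zero (C X * X - C X + X) 5 3
    (by norm_num [Polynomial.evalEval])
  simpa [polyToRF_C_X, polyToRF_X, map_ofNat] using h

lemma snd_iterate_one_ne : xF * yF - 2 * xF + yF ≠ 0 := by
  have h := polyToRF_ne_zero (C X * X - 2 * C X + X) 5 3
    (by norm_num [Polynomial.evalEval])
  simpa [polyToRF_C_X, polyToRF_X, map_ofNat] using h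

lemma snd_iterate_two_ne : xF - yF * (xF - yF) ≠ 0 := by
  have h := polyToRF_ne_zero (C X - X * (C X - X)) 5 3
    (by norm_num [Polynomial.evalEval])
  simpa [polyToRF_C_X, polyToRF_X, map_ofNat] using h

lemma snd_iterate_three_ne : xF * yF - xF + yF - yF ^ 3 ≠ 0 := by
  have h := polyToRF_ne_zero (C X * X - C X + X - X ^ 3) 5 3
    (by norm_num [Polynomial.evalEval])
  simpa [polyToRF_C_X, polyToRF_X, map_ofNat] using h

lemma snd_iterate_four_ne : xF * yF - xF + yF - xF * yF * (yF - 1) ≠ 0 := by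
  have h := polyToRF_ne_zero (C X * X - C X + X - C X * X * (X - 1)) 5 3
    (by norm_num [Polynomial.evalEval])
  simpa [polyToRF_C_X, polyToRF_X, map_ofNat] using h

end Nonvanishing

section GenericField

variable {F : Type*} [Field F]

/-- The kernel `K(u,v)` over an arbitrary field. -/
def kerField (t u v : F) : F :=
  1 - t * u - t * u * v ^ 2 / ((u - v) * (v - 1))

/-- The transformation `Φ` over an arbitrary field. -/
def phiField (p : F × F) : F × F :=
  (p.2 * (p.1 * p.2 - p.1 + p.2) / ((p.1 - p.2) * (p.2 - 1)), p.2)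

/-- The transformation `Ψ` over an arbitrary field. -/
def psiField (p : F × F) : F × F :=
  (p.1, p.1 * p.2 / (p.1 * p.2 - p.1 + p.2))

lemma phiField_psiField {u v : F} (hu : u ≠ 0) (hv : v ≠ 0) (huv : u - v ≠ 0) (hv1 : v - 1 ≠ 0)
    (hw : u * v - u + v ≠ 0) :
    phiField (psiField (u, v)) = (u * v / ((u - v) * (v - 1)), u * v / (u * v - u + v)) := by
  simp only [phiField, psiField, Prod.mk.injEq, and_true]
  generalize h : u * v - u + v = w at *
  have h1 : u * (u * v / w) - u + u * v / w = u ^ 2 / w := by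
    field_simp; rw [← h]; ring1
  have h2 : u - u * v / w = u ^ 2 * (v - 1) / w := by
    field_simp; rw [← h]; ring1
  have h3 : u * v / w - 1 = (u - v) / w := by
    field_simp; rw [← h]; ring1
  rw [h1, h2, h3]
  field_simp

/-- One step of `Φ ∘ Ψ`, with the factors occurring in it given in simplified form. -/
lemma phiField_psiField_eq {u v d e w u' v' : F} (hu : u ≠ 0) (hv : v ≠ 0) (hd : d ≠ 0)
    (he : e ≠ 0) (hw : w ≠ 0) (h1 : u - v = d) (h2 : v - 1 = e) (h3 : u * v - u + v = w)
    (h4 : u * v / (d * e) = u') (h5 : u * v / w = v') :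
    (phiField ∘ psiField) (u, v) = (u', v') := by
  subst h1 h2 h3 h4 h5
  exact phiField_psiField hu hv hd he hw

/-- The properties of `Φ` and `Ψ` at a point `(x, y)` of the plane over a field, away from the
vanishing loci of the polynomials involved. -/
lemma phiField_psiField_dihedral (t : F) {x y : F} (hx : x ≠ 0) (hy : y ≠ 0) (hd : x - y ≠ 0)
    (he : y - 1 ≠ 0) (hxy : x * y - x + y ≠ 0) (n1 : x * y - 2 * x + y ≠ 0)
    (n2 : x - y * (x - y) ≠ 0) (n3 : x * y - x + y - y ^ 3 ≠ 0)
    (n4 : x * y - x + y - x * y * (y - 1) ≠ 0) :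
    kerField t (phiField (x, y)).1 (phiField (x, y)).2 = kerField t x y ∧
    kerField t (psiField (x, y)).1 (psiField (x, y)).2 = kerField t x y ∧
    phiField (phiField (x, y)) = (x, y) ∧
    psiField (psiField (x, y)) = (x, y) ∧
    (phiField ∘ psiField)^[5] (x, y) = (x, y) ∧
    ∀ k : ℕ, 0 < k → k < 5 → (phiField ∘ psiField)^[k] (x, y) ≠ (x, y) := by
  obtain ⟨w, hw⟩ : ∃ w, w = x * y - x + y := ⟨_, rfl⟩
  have hw0 : w ≠ 0 := hw ▸ hxy
  have hPhi : phiField (x, y) = (y * w / ((x - y) * (y - 1)), y) := by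
    simp only [phiField, hw]
  have hPsi : psiField (x, y) = (x, x * y / w) := by
    simp only [psiField, hw]
  have s1 : (phiField ∘ psiField) (x, y) = (x * y / ((x - y) * (y - 1)), x * y / w) :=
    phiField_psiField_eq hx hy hd he hw0 rfl rfl hw.symm rfl rfl
  have s2 : (phiField ∘ psiField) (x * y / ((x - y) * (y - 1)), x * y / w)
      = (x * w / (y * (x - y)), x / (x - y)) := by
    apply phiField_psiField_eq (d := x * y ^ 3 / ((x - y) * (y - 1) * w)) (e := (x - y) / w)
      (w := x * y ^ 2 / ((y - 1) * w)) <;>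
      first
      | ((repeat' first
          | assumption | apply div_ne_zero | apply mul_ne_zero | apply pow_ne_zero); done)
      | (field_simp; done)
      | (field_simp; rw [hw]; ring1)
  have s3 : (phiField ∘ psiField) (x * w / (y * (x - y)), x / (x - y))
      = (w / (y * (y - 1)), w / y ^ 2) := by
    apply phiField_psiField_eq (d := x ^ 2 * (y - 1) / (y * (x - y))) (e := y / (x - y))
      (w := x ^ 2 * y / (x - y) ^ 2) <;>
      first
      | ((repeat' first
          | assumption | apply div_ne_zero | apply mul_ne_zero | apply pow_ne_zero); done)
      | (field_simp; done)
      | (field_simp; rw [hw]; ring1)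
      | (field_simp; ring1)
  have s4 : (phiField ∘ psiField) (w / (y * (y - 1)), w / y ^ 2)
      = (w * y / ((x - y) * (y - 1)), w / (x * (y - 1))) := by
    apply phiField_psiField_eq (d := w / (y ^ 2 * (y - 1))) (e := (x - y) * (y - 1) / y ^ 2)
      (w := w * x / y ^ 3) <;>
      first
      | ((repeat' first
          | assumption | apply div_ne_zero | apply mul_ne_zero | apply pow_ne_zero); done)
      | (field_simp; done)
      | (field_simp; rw [hw]; ring1)
      | (field_simp; ring1)
  have s5 : (phiField ∘ psiField) (w * y / ((x - y) * (y - 1)), w / (x * (y - 1))) = (x, y) := by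
    apply phiField_psiField_eq (d := w ^ 2 / (x * (x - y) * (y - 1))) (e := y / (x * (y - 1)))
      (w := w ^ 2 / ((x - y) * (y - 1) ^ 2) / x) <;>
      first
      | ((repeat' first
          | assumption | apply div_ne_zero | apply mul_ne_zero | apply pow_ne_zero); done)
      | (field_simp; done)
      | (field_simp; rw [hw]; ring1)
  refine ⟨?_, ?_, ?_, ?_, ?_, ?_⟩
  · have h : y * w / ((x - y) * (y - 1)) - y = y ^ 3 / ((x - y) * (y - 1)) := by
      field_simp; rw [hw]; ring
    rw [hPhi]
    simp only [kerField, h]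
    field_simp
    rw [hw]; ring
  · have h1 : x - x * y / w = x ^ 2 * (y - 1) / w := by field_simp; rw [hw]; ring
    have h2 : x * y / w - 1 = (x - y) / w := by field_simp; rw [hw]; ring
    rw [hPsi]
    simp only [kerField, h1, h2]
    field_simp
  · have h : y * w / ((x - y) * (y - 1)) - y = y ^ 3 / ((x - y) * (y - 1)) := by
      field_simp; rw [hw]; ring
    have h' : y * w / ((x - y) * (y - 1)) * y - y * w / ((x - y) * (y - 1)) + y
        = x * y ^ 2 / ((x - y)) := by
      field_simp; rw [hw]; ring
    rw [hPhi]
    simp only [phiField, h, h', Prod.mk.injEq, and_true]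
    field_simp
  · have h : x * (x * y / w) - x + x * y / w = x ^ 2 / w := by field_simp; rw [hw]; ring
    rw [hPsi]
    simp only [psiField, h, Prod.mk.injEq, true_and]
    field_simp
  · simp only [Function.iterate_succ_apply, Function.iterate_zero_apply, s1, s2, s3, s4, s5]
  · intro k hk hk5 h
    interval_cases k <;>
      simp only [Function.iterate_succ_apply, Function.iterate_zero_apply, s1, s2, s3, s4,
        Prod.mk.injEq] at h <;> obtain ⟨-, h⟩ := h <;> field_simp at h
    · exact n1 (by linear_combination -hw - h)
    · exact n2 (by linear_combination h)
    · exact n3 (by linear_combination h - hw)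
    · exact n4 (by linear_combination h - hw)

end GenericField

/-- `Φ` and `Ψ` preserve the kernel `K`, are involutions, and generate a dihedral group of
order 10: `Φ∘Ψ` has order exactly 5. -/
theorem stmt15 :
    Ker (PhiT (xF, yF)).1 (PhiT (xF, yF)).2 = Ker xF yF ∧
    Ker (PsiT (xF, yF)).1 (PsiT (xF, yF)).2 = Ker xF yF ∧
    PhiT (PhiT (xF, yF)) = (xF, yF) ∧
    PsiT (PsiT (xF, yF)) = (xF, yF) ∧
    (PhiT ∘ PsiT)^[5] (xF, yF) = (xF, yF) ∧
    ∀ k : ℕ, 0 < k → k < 5 → (PhiT ∘ PsiT)^[k] (xF, yF) ≠ (xF, yF) := by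
  exact phiField_psiField_dihedral tF xF_ne_zero yF_ne_zero xF_sub_yF_ne_zero yF_sub_one_ne_zero
    xF_mul_yF_sub_add_ne_zero snd_iterate_one_ne snd_iterate_two_ne snd_iterate_three_ne
    snd_iterate_four_ne
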